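/- arXiv:math/0606038 — 2 statements merged into one kernel-verified Lean document; each statement's English description precedes it below -/
import Mathlib

section
/- Let E0 ∈ ℝ, L ≥ 1, δ > 0 and n ≥ 2. If at least n of the zeros of the orthonormal polynomial p_L lie in the closed interval [E0 − δ, E0 + δ], then δ·‖A_L(E0)‖_HS ≥ (1/2)·√n. -/
open scoped BigOperators

/-- The solution of the Jacobi difference equation at energy `E` with
boundary condition angle `θ`: `u 0 = sin θ`, `u 1 = cos θ`, and
`a n * u (n+1) + (b n - E) * u n + a (n-1) * u (n-1) = 0` for `n ≥ 1`. -/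
noncomputable def jacobiSol (a b : ℕ → ℝ) (E θ : ℝ) : ℕ → ℝ
  | 0 => Real.sin θ
  | 1 => Real.cos θ
  | (n+2) => (-((b (n+1) - E) * jacobiSol a b E θ (n+1) + a n * jacobiSol a b E θ n)) / a (n+1)

/-- The orthonormal polynomial `p n` evaluated at `x`. -/
noncomputable def orthoP (a b : ℕ → ℝ) (n : ℕ) (x : ℝ) : ℝ := jacobiSol a b x 0 (n+1)

/-- The kernel `K(n,m;E)`. -/
noncomputable def Kker (a b : ℕ → ℝ) (E : ℝ) (n m : ℕ) : ℝ :=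
  jacobiSol a b E 0 n * jacobiSol a b E (Real.pi/2) m
    - jacobiSol a b E (Real.pi/2) n * jacobiSol a b E 0 m

/-- The matrix of the operator `A_L(E)`. -/
noncomputable def AL (a b : ℕ → ℝ) (E : ℝ) (L : ℕ) : Matrix (Fin L) (Fin L) ℝ :=
  Matrix.of fun i j =>
    if (j : ℕ) ≤ (i : ℕ) then Kker a b E ((i : ℕ) + 1) ((j : ℕ) + 1) else 0

/-- The Hilbert–Schmidt (Frobenius) norm of a real matrix. -/
noncomputable def hsNorm {L : ℕ} (A : Matrix (Fin L) (Fin L) ℝ) : ℝ :=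
  Real.sqrt (∑ i, ∑ j, (A i j) ^ 2)

lemma jac_rec (a b : ℕ → ℝ) (ha : ∀ n, 0 < a n) (E θ : ℝ) (k : ℕ) :
    a (k+1) * jacobiSol a b E θ (k+2) =
      (E - b (k+1)) * jacobiSol a b E θ (k+1) - a k * jacobiSol a b E θ k := by
  have h := (ha (k+1)).ne'
  rw [jacobiSol]
  field_simp
  ring

lemma jac_wron (a b : ℕ → ℝ) (ha : ∀ n, 0 < a n) (ha0 : a 0 = 1) (E : ℝ) (k : ℕ) :
    a k * (jacobiSol a b E 0 (k+1) * jacobiSol a b E (Real.pi/2) k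
      - jacobiSol a b E (Real.pi/2) (k+1) * jacobiSol a b E 0 k) = 1 := by
  induction k with
  | zero => simp [jacobiSol, ha0]
  | succ k ih =>
    have h1 := jac_rec a b ha E 0 k
    have h2 := jac_rec a b ha E (Real.pi/2) k
    linear_combination ih + jacobiSol a b E (Real.pi/2) (k+1) * h1 - jacobiSol a b E 0 (k+1) * h2

lemma jac_cd (a b : ℕ → ℝ) (ha : ∀ n, 0 < a n) (x y : ℝ) (k : ℕ) :
    (x - y) * ∑ m ∈ Finset.range k, jacobiSol a b x 0 (m+1) * jacobiSol a b y 0 (m+1) =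
    a k * (jacobiSol a b x 0 (k+1) * jacobiSol a b y 0 k
      - jacobiSol a b x 0 k * jacobiSol a b y 0 (k+1)) := by
  induction k with
  | zero => simp [jacobiSol]
  | succ k ih =>
    have h1 := jac_rec a b ha x 0 k
    have h2 := jac_rec a b ha y 0 k
    rw [Finset.sum_range_succ]
    linear_combination ih - jacobiSol a b y 0 (k+1) * h1 + jacobiSol a b x 0 (k+1) * h2

lemma jac_var (a b : ℕ → ℝ) (ha : ∀ n, 0 < a n) (ha0 : a 0 = 1) (x E : ℝ) (k : ℕ) :
    jacobiSol a b x 0 k = jacobiSol a b E 0 k + (x - E) *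
      (jacobiSol a b E 0 k * ∑ m ∈ Finset.range k,
          jacobiSol a b E (Real.pi/2) (m+1) * jacobiSol a b x 0 (m+1)
       - jacobiSol a b E (Real.pi/2) k * ∑ m ∈ Finset.range k,
          jacobiSol a b E 0 (m+1) * jacobiSol a b x 0 (m+1)) := by
  induction k using Nat.twoStepInduction with
  | zero => simp [jacobiSol]
  | one => simp [jacobiSol]
  | more k ih1 ih2 =>
    have h1 := jac_rec a b ha E 0 k
    have h2 := jac_rec a b ha E (Real.pi/2) k
    have h3 := jac_rec a b ha x 0 k
    have hw := jac_wron a b ha ha0 E (k+1)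
    apply mul_left_cancel₀ (ha (k+1)).ne'
    simp only [Finset.sum_range_succ] at ih1 ih2 ⊢
    set P := ∑ m ∈ Finset.range k, jacobiSol a b E (Real.pi/2) (m+1) * jacobiSol a b x 0 (m+1)
    set Q := ∑ m ∈ Finset.range k, jacobiSol a b E 0 (m+1) * jacobiSol a b x 0 (m+1)
    have hw0 := jac_wron a b ha ha0 E k
    simp only [show k + 1 + 1 = k + 2 from rfl] at *
    set U0 := jacobiSol a b x 0 k
    set U1 := jacobiSol a b x 0 (k+1)
    set U2 := jacobiSol a b x 0 (k+2)
    set u0 := jacobiSol a b E 0 k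
    set u1 := jacobiSol a b E 0 (k+1)
    set u2 := jacobiSol a b E 0 (k+2)
    set v0 := jacobiSol a b E (Real.pi/2) k
    set v1 := jacobiSol a b E (Real.pi/2) (k+1)
    set v2 := jacobiSol a b E (Real.pi/2) (k+2)
    linear_combination h3 + (E - b (k+1)) * ih2 - a k * ih1
      - (1 + (x - E) * P) * h1 + (x - E) * Q * h2 - (x - E) * U1 * hw

lemma AL_apply (a b : ℕ → ℝ) (ha : ∀ n, 0 < a n) (ha0 : a 0 = 1) (x E : ℝ) (L : ℕ) (i : Fin L) :
    jacobiSol a b x 0 (i+1) = jacobiSol a b E 0 (i+1) +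
      (x - E) * ∑ j, AL a b E L i j * jacobiSol a b x 0 (j+1) := by
  have h := jac_var a b ha ha0 x E (i+1)
  have h2 : ∑ j, AL a b E L i j * jacobiSol a b x 0 (j+1) =
      ∑ m ∈ Finset.range (i+1), Kker a b E (i+1) (m+1) * jacobiSol a b x 0 (m+1) := by
    refine (Fin.sum_univ_eq_sum_range (fun j => (if j ≤ (i:ℕ) then Kker a b E (i+1) (j+1) else 0)
      * jacobiSol a b x 0 (j+1)) L).trans ?_
    simp only [ite_mul, zero_mul]
    rw [← Finset.sum_filter]
    apply Finset.sum_congr _ (fun _ _ => rfl)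
    ext m
    have := i.2
    simp only [Finset.mem_filter, Finset.mem_range]
    omega
  rw [h2]
  conv_lhs => rw [h]
  simp only [Kker, Finset.mul_sum, ← Finset.sum_sub_distrib]
  congr 1
  apply Finset.sum_congr rfl
  intros
  ring

theorem stmt_2 (a b : ℕ → ℝ) (ha : ∀ n, 0 < a n) (ha0 : a 0 = 1)
    (E0 δ : ℝ) (hδ : 0 < δ) (L n : ℕ) (hL : 1 ≤ L) (hn : 2 ≤ n)
    (hzeros : ∃ S : Finset ℝ, n ≤ S.card ∧
      ∀ x ∈ S, orthoP a b L x = 0 ∧ x ∈ Set.Icc (E0 - δ) (E0 + δ)) :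
    Real.sqrt n / 2 ≤ δ * hsNorm (AL a b E0 L) := by
  obtain ⟨S, hS, hz⟩ := hzeros
  let φ : ℝ → EuclideanSpace ℝ (Fin L) := fun x => WithLp.toLp 2 fun i => jacobiSol a b x 0 (i+1)
  have hφ : ∀ x, φ x ≠ 0 := by
    intro x h
    have := congrArg (fun v : EuclideanSpace ℝ (Fin L) => v ⟨0, hL⟩) h
    simp [φ, jacobiSol] at this
  have hφn : ∀ x, 0 < ‖φ x‖ := fun x => norm_pos_iff.2 (hφ x)
  let R : Fin L → EuclideanSpace ℝ (Fin L) := fun i => WithLp.toLp 2 (AL a b E0 L i)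
  have hinner : ∀ i x, inner ℝ (φ x) (R i) = ∑ j, AL a b E0 L i j * jacobiSol a b x 0 (j+1) := by
    intro i x
    simp [φ, R, PiLp.inner_apply]
  let e : S → EuclideanSpace ℝ (Fin L) := fun x => (‖φ x‖)⁻¹ • φ x
  have hen : ∀ x, ‖e x‖ = 1 := by
    intro x
    simp only [e, norm_smul, norm_inv, norm_norm]
    exact inv_mul_cancel₀ (hφn x).ne'
  have he : Orthonormal ℝ e := by
    refine ⟨hen, ?_⟩
    intro x y hxy
    simp only [e, inner_smul_left, inner_smul_right]
    have hne : (x:ℝ) - y ≠ 0 := sub_ne_zero.2 (fun h => hxy (Subtype.ext h))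
    have h1 := jac_cd a b ha x y L
    have hx := (hz x x.2).1
    have hy := (hz y y.2).1
    unfold orthoP at hx hy
    rw [hx, hy] at h1
    simp only [zero_mul, mul_zero, sub_zero] at h1
    have h2 := (mul_eq_zero.1 h1).resolve_left hne
    have h3 : inner ℝ (φ x) (φ y) = 0 := by
      rw [← h2, ← Fin.sum_univ_eq_sum_range
        (fun m => jacobiSol a b x 0 (m+1) * jacobiSol a b y 0 (m+1))]
      simp [φ, PiLp.inner_apply, mul_comm]
    rw [h3]; simp
  let v : EuclideanSpace ℝ (Fin L) := (‖φ E0‖)⁻¹ • φ E0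
  have hv : ‖v‖ = 1 := by
    simp only [v, norm_smul, norm_inv, norm_norm]
    exact inv_mul_cancel₀ (hφn E0).ne'
  -- key inequality
  have key : ∀ x : S, 1 - (inner ℝ (e x) v)^2 ≤ δ^2 * ∑ i, (inner ℝ (e x) (R i))^2 := by
    intro x
    let c : ℝ := x - E0
    let t : ℝ := (‖φ x‖)⁻¹ * ‖φ E0‖
    have hc : c^2 ≤ δ^2 := by
      have := (hz x x.2).2
      apply sq_le_sq'
      · simp only [c]; linarith [this.1]
      · simp only [c]; linarith [this.2]
    have h1 : ∀ i, (e x - t • v) i = c * inner ℝ (e x) (R i) := by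
      intro i
      have h := AL_apply a b ha ha0 x E0 L i
      rw [← hinner] at h
      have e1 : e x i = (‖φ x‖)⁻¹ * jacobiSol a b x 0 (i+1) := by simp [e, φ]
      have e2 : (t • v) i = (‖φ x‖)⁻¹ * jacobiSol a b E0 0 (i+1) := by
        have : t • v = (‖φ x‖)⁻¹ • φ E0 := by
          simp only [t, v, smul_smul]
          rw [mul_assoc, mul_inv_cancel₀ (hφn E0).ne', mul_one]
        rw [this]; simp [φ]
      have e3 : inner ℝ (e x) (R i) = (‖φ x‖)⁻¹ * inner ℝ (φ x) (R i) := by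
        simp [e, inner_smul_left]
      rw [PiLp.sub_apply, e1, e2, e3]
      simp only [c]
      linear_combination (‖φ x‖)⁻¹ * h
    have h2 : ‖e x - t • v‖^2 = c^2 * ∑ i, (inner ℝ (e x) (R i))^2 := by
      rw [EuclideanSpace.norm_sq_eq, Finset.mul_sum]
      apply Finset.sum_congr rfl
      intro i _
      rw [h1, Real.norm_eq_abs, sq_abs, mul_pow]
    have h3 : ‖e x - t • v‖^2 = 1 - 2 * t * inner ℝ (e x) v + t^2 := by
      rw [norm_sub_sq_real, hen, norm_smul, hv, inner_smul_right, Real.norm_eq_abs, mul_one, sq_abs]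
      ring
    have h4 : 0 ≤ ∑ i, (inner ℝ (e x) (R i))^2 := Finset.sum_nonneg fun i _ => sq_nonneg _
    nlinarith [sq_nonneg (t - inner ℝ (e x) v), mul_le_mul_of_nonneg_right hc h4]
  have bes : ∀ w : EuclideanSpace ℝ (Fin L), ∑ x, (inner ℝ (e x) w)^2 ≤ ‖w‖^2 := by
    intro w
    have := he.sum_inner_products_le (s := Finset.univ) w
    simpa using this
  have hsum := Finset.sum_le_sum (fun x (_ : x ∈ (Finset.univ : Finset S)) => key x)
  rw [Finset.sum_sub_distrib, ← Finset.mul_sum, Finset.sum_comm] at hsum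
  have hb := bes v
  rw [hv] at hb
  have hHS : ∑ i, ∑ x, (inner ℝ (e x) (R i))^2 ≤ ∑ i, ∑ j, (AL a b E0 L i j)^2 := by
    apply Finset.sum_le_sum
    intro i _
    refine (bes (R i)).trans (le_of_eq ?_)
    rw [EuclideanSpace.norm_sq_eq]
    simp [R]
  have hcard : (n:ℝ) ≤ ∑ x : S, (1:ℝ) := by
    simp; exact_mod_cast hS
  have hn' : (2:ℝ) ≤ n := by exact_mod_cast hn
  have hfin : (n:ℝ)/4 ≤ δ^2 * ∑ i, ∑ j, (AL a b E0 L i j)^2 := by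
    have := mul_le_mul_of_nonneg_left hHS (sq_nonneg δ)
    linarith
  unfold hsNorm
  have : δ * Real.sqrt (∑ i, ∑ j, (AL a b E0 L i j)^2)
      = Real.sqrt (δ^2 * ∑ i, ∑ j, (AL a b E0 L i j)^2) := by
    rw [Real.sqrt_mul (sq_nonneg δ), Real.sqrt_sq hδ.le]
  rw [this]
  apply Real.le_sqrt_of_sq_le
  rw [div_pow, Real.sq_sqrt (by positivity)]
  linarith
end

section
/- Let Δ ⊂ ℝ be an interval on which τ_Δ := sup{ (1 + a_{n+1}²)·‖T(n,E)‖² : n ≥ 0, E ∈ Δ } < ∞. Then for every n ≥ 1: (a) any two successive zeros E < E′ of p_n with E, E′ ∈ Δ satisfy a_n·π/(τ_Δ²·n) ≤ E′ − E ≤ 2·a_n·π·τ_Δ²/n; (b) if Δ = [α, β] with β − α ≥ 2a_nπτ_Δ²/n, then p_n has a zero in [β − 2a_nπτ_Δ²/n, β] and a zero in [α, α + 2a_nπτ_Δ²/n]. -/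
open scoped BigOperators

/-- The transfer matrix `T(n,E)`. -/
noncomputable def transferT (a b : ℕ → ℝ) (n : ℕ) (E : ℝ) : Matrix (Fin 2) (Fin 2) ℝ :=
  !![jacobiSol a b E 0 (n+1), jacobiSol a b E (Real.pi/2) (n+1);
     jacobiSol a b E 0 n,     jacobiSol a b E (Real.pi/2) n]

/-- The operator norm of a real matrix acting on Euclidean space. -/
noncomputable def matOpNorm {m n : ℕ} (A : Matrix (Fin m) (Fin n) ℝ) : ℝ :=
  ‖LinearMap.toContinuousLinearMap (Matrix.toEuclideanLin A)‖

lemma aux_upper (f g f' g' : ℝ → ℝ) (hf : ∀ x, HasDerivAt f (f' x) x)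
    (hg : ∀ x, HasDerivAt g (g' x) x) (c p q : ℝ) (hpq : p ≤ q)
    (hW : ∀ x ∈ Set.Icc p q, c * (f x ^ 2 + g x ^ 2) ≤ f' x * g x - f x * g' x)
    (hne : ∀ x ∈ Set.Icc p q, f x ≠ 0) : c * (q - p) < Real.pi := by
  have hd : ∀ x ∈ Set.Icc p q, HasDerivAt (fun y => Real.arctan (g y / f y) + c * y)
      (1 / (1 + (g x / f x) ^ 2) * ((g' x * f x - g x * f' x) / f x ^ 2) + c * 1) x := by
    intro x hx
    exact (((hg x).div (hf x) (hne x hx)).arctan).add ((hasDerivAt_id x).const_mul c)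
  have hanti : AntitoneOn (fun y => Real.arctan (g y / f y) + c * y) (Set.Icc p q) := by
    apply antitoneOn_of_deriv_nonpos (convex_Icc p q)
    · intro x hx
      exact (hd x hx).continuousAt.continuousWithinAt
    · intro x hx
      exact (hd x (interior_subset hx)).differentiableAt.differentiableWithinAt
    · intro x hx
      have hx' := interior_subset hx
      rw [(hd x hx').deriv]
      have h0 := hne x hx'
      have hw := hW x hx'
      have h1 : 0 < f x ^ 2 := by positivity
      have h2 : 1 / (1 + (g x / f x) ^ 2) * ((g' x * f x - g x * f' x) / f x ^ 2) + c * 1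
          = (c * (f x ^ 2 + g x ^ 2) - (f' x * g x - f x * g' x)) / (f x ^ 2 + g x ^ 2) := by
        have h3 : f x ^ 2 + g x ^ 2 ≠ 0 := by positivity
        have h4 : 1 + (g x / f x) ^ 2 = (f x ^ 2 + g x ^ 2) / f x ^ 2 := by
          field_simp
        rw [h4]
        field_simp
        ring
      rw [h2]
      apply div_nonpos_of_nonpos_of_nonneg (by linarith) (by positivity)
  have h := hanti (Set.left_mem_Icc.2 hpq) (Set.right_mem_Icc.2 hpq) hpq
  simp only at h
  have h1 := Real.arctan_lt_pi_div_two (g p / f p)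
  have h2 := Real.neg_pi_div_two_lt_arctan (g q / f q)
  linarith

lemma aux_lower (f g f' g' : ℝ → ℝ) (hf : ∀ x, HasDerivAt f (f' x) x)
    (hg : ∀ x, HasDerivAt g (g' x) x) (c p q : ℝ) (hpq : p < q)
    (hW : ∀ x ∈ Set.Icc p q, f' x * g x - f x * g' x ≤ c * (f x ^ 2 + g x ^ 2))
    (hWpos : ∀ x ∈ Set.Icc p q, 0 < f' x * g x - f x * g' x)
    (hfp : f p = 0) (hfq : f q = 0)
    (hne : ∀ x ∈ Set.Ioo p q, f x ≠ 0) : Real.pi ≤ c * (q - p) := by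
  have hd : ∀ x ∈ Set.Ioo p q, HasDerivAt (fun y => Real.arctan (g y / f y) + c * y)
      (1 / (1 + (g x / f x) ^ 2) * ((g' x * f x - g x * f' x) / f x ^ 2) + c * 1) x := by
    intro x hx
    exact (((hg x).div (hf x) (hne x hx)).arctan).add ((hasDerivAt_id x).const_mul c)
  have hmono : MonotoneOn (fun y => Real.arctan (g y / f y) + c * y) (Set.Ioo p q) := by
    apply monotoneOn_of_deriv_nonneg (convex_Ioo p q)
    · intro x hx
      exact (hd x hx).continuousAt.continuousWithinAt
    · intro x hx
      exact (hd x (interior_subset hx)).differentiableAt.differentiableWithinAt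
    · intro x hx
      have hx' := interior_subset hx
      rw [(hd x hx').deriv]
      have h0 := hne x hx'
      have hw := hW x (Set.Ioo_subset_Icc_self hx')
      have h1 : 0 < f x ^ 2 := by positivity
      have h2 : 1 / (1 + (g x / f x) ^ 2) * ((g' x * f x - g x * f' x) / f x ^ 2) + c * 1
          = (c * (f x ^ 2 + g x ^ 2) - (f' x * g x - f x * g' x)) / (f x ^ 2 + g x ^ 2) := by
        have h3 : f x ^ 2 + g x ^ 2 ≠ 0 := by positivity
        have h4 : 1 + (g x / f x) ^ 2 = (f x ^ 2 + g x ^ 2) / f x ^ 2 := by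
          field_simp
        rw [h4]
        field_simp
        ring
      rw [h2]
      apply div_nonneg (by linarith) (by positivity)
  -- g p / f -> +∞ : f / g has positive derivative at the ends
  have key : ∀ z ∈ Set.Icc p q, f z = 0 → ∃ d, 0 < d ∧ g z ≠ 0 ∧
      HasDerivAt (fun y => f y / g y) d z := by
    intro z hz h0
    have hw := hWpos z hz
    rw [h0] at hw
    have hgz : g z ≠ 0 := by
      intro h; rw [h] at hw; simp at hw
    refine ⟨_, ?_, hgz, (hf z).div (hg z) hgz⟩
    rw [h0]
    apply div_pos (by linarith) (by positivity)
  obtain ⟨d, hd0, hgp, hdp⟩ := key p (Set.left_mem_Icc.2 hpq.le) hfp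
  obtain ⟨e, he0, hgq, heq⟩ := key q (Set.right_mem_Icc.2 hpq.le) hfq
  have hp1 : Filter.Tendsto (fun y => f y / g y) (nhdsWithin p (Set.Ioi p))
      (nhdsWithin 0 (Set.Ioi 0)) := by
    apply tendsto_nhdsWithin_of_tendsto_nhds_of_eventually_within
    · have := hdp.continuousAt.tendsto
      simp only [hfp, zero_div] at this
      exact this.mono_left nhdsWithin_le_nhds
    · have h := hasDerivAt_iff_tendsto_slope.1 hdp
      have h1 := (h.eventually (lt_mem_nhds hd0)).filter_mono
        (nhdsWithin_mono p (fun x (hx : p < x) => (ne_of_gt hx : x ≠ p)))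
      filter_upwards [h1, self_mem_nhdsWithin] with x hx hxp
      rw [slope_def_field] at hx
      simp only [hfp, zero_div, sub_zero] at hx
      have : 0 < x - p := sub_pos.2 hxp
      exact (div_pos_iff_of_pos_right this).1 hx
  have hq1 : Filter.Tendsto (fun y => f y / g y) (nhdsWithin q (Set.Iio q))
      (nhdsWithin 0 (Set.Iio 0)) := by
    apply tendsto_nhdsWithin_of_tendsto_nhds_of_eventually_within
    · have := heq.continuousAt.tendsto
      simp only [hfq, zero_div] at this
      exact this.mono_left nhdsWithin_le_nhds
    · have h := hasDerivAt_iff_tendsto_slope.1 heq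
      have h1 := (h.eventually (lt_mem_nhds he0)).filter_mono
        (nhdsWithin_mono q (fun x (hx : x < q) => (ne_of_lt hx : x ≠ q)))
      filter_upwards [h1, self_mem_nhdsWithin] with x hx hxp
      rw [slope_def_field] at hx
      simp only [hfq, zero_div, sub_zero] at hx
      have h3 : x - q < 0 := sub_neg.2 hxp
      by_contra hcon
      have h4 : 0 ≤ f x / g x := not_lt.1 hcon
      have := div_nonpos_of_nonneg_of_nonpos h4 h3.le
      linarith
  have hp2 : Filter.Tendsto (fun y => Real.arctan (g y / f y) + c * y)
      (nhdsWithin p (Set.Ioi p)) (nhds (Real.pi / 2 + c * p)) := by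
    apply Filter.Tendsto.add
    · have := (tendsto_inv_nhdsGT_zero (𝕜 := ℝ)).comp hp1
      have h2 := (Real.tendsto_arctan_atTop.mono_right nhdsWithin_le_nhds).comp this
      simpa [Function.comp_def, inv_div] using h2
    · exact ((continuous_const.mul continuous_id).tendsto p).mono_left nhdsWithin_le_nhds
  have hq2 : Filter.Tendsto (fun y => Real.arctan (g y / f y) + c * y)
      (nhdsWithin q (Set.Iio q)) (nhds (-(Real.pi / 2) + c * q)) := by
    apply Filter.Tendsto.add
    · have := (tendsto_inv_nhdsLT_zero (𝕜 := ℝ)).comp hq1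
      have h2 := (Real.tendsto_arctan_atBot.mono_right nhdsWithin_le_nhds).comp this
      simpa [Function.comp_def, inv_div] using h2
    · exact ((continuous_const.mul continuous_id).tendsto q).mono_left nhdsWithin_le_nhds
  have h1 : ∀ y ∈ Set.Ioo p q, Real.pi / 2 + c * p ≤ Real.arctan (g y / f y) + c * y := by
    intro y hy
    apply le_of_tendsto hp2
    filter_upwards [Ioo_mem_nhdsGT hy.1] with x hx
    exact hmono ⟨hx.1, hx.2.trans hy.2⟩ hy hx.2.le
  have h2 : Real.pi / 2 + c * p ≤ -(Real.pi / 2) + c * q := by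
    apply ge_of_tendsto hq2
    filter_upwards [Ioo_mem_nhdsLT hpq] with x hx
    exact h1 x hx
  linarith

lemma aux_diff (a b : ℕ → ℝ) (θ : ℝ) : ∀ n, Differentiable ℝ (fun E => jacobiSol a b E θ n)
  | 0 => by simp only [jacobiSol]; fun_prop
  | 1 => by simp only [jacobiSol]; fun_prop
  | (n+2) => by
    have h1 := aux_diff a b θ (n+1)
    have h2 := aux_diff a b θ n
    simp only [jacobiSol]
    fun_prop

lemma aux_rec (a b : ℕ → ℝ) (ha : ∀ n, 0 < a n) (θ E : ℝ) (n : ℕ) :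
    a (n+1) * jacobiSol a b E θ (n+2)
      = (E - b (n+1)) * jacobiSol a b E θ (n+1) - a n * jacobiSol a b E θ n := by
  have := (ha (n+1)).ne'
  rw [jacobiSol]
  field_simp
  ring

lemma aux_wron (a b : ℕ → ℝ) (ha : ∀ n, 0 < a n) (ha0 : a 0 = 1) (E : ℝ) (n : ℕ) :
    a n * (jacobiSol a b E 0 (n+1) * jacobiSol a b E (Real.pi/2) n
      - jacobiSol a b E 0 n * jacobiSol a b E (Real.pi/2) (n+1)) = 1 := by
  induction n with
  | zero => simp [jacobiSol, ha0]
  | succ n ih =>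
    have h1 := aux_rec a b ha 0 E n
    have h2 := aux_rec a b ha (Real.pi/2) E n
    linear_combination ih + jacobiSol a b E (Real.pi/2) (n+1) * h1
      - jacobiSol a b E 0 (n+1) * h2

/-- derivative Wronskian identity -/
lemma aux_cd (a b : ℕ → ℝ) (u : ℕ → ℝ → ℝ) (hu : ∀ n, Differentiable ℝ (u n))
    (hr : ∀ n E, a (n+1) * u (n+2) E = (E - b (n+1)) * u (n+1) E - a n * u n E) (n : ℕ) (E : ℝ) :
    a (n+1) * (deriv (u (n+2)) E * u (n+1) E - u (n+2) E * deriv (u (n+1)) E)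
      = a n * (deriv (u (n+1)) E * u n E - u (n+1) E * deriv (u n) E) + u (n+1) E ^ 2 := by
  have h1 : HasDerivAt (fun E => a (n+1) * u (n+2) E) (a (n+1) * deriv (u (n+2)) E) E :=
    ((hu (n+2)) E).hasDerivAt.const_mul _
  have h2 : HasDerivAt (fun E => (E - b (n+1)) * u (n+1) E - a n * u n E)
      (1 * u (n+1) E + (E - b (n+1)) * deriv (u (n+1)) E - a n * deriv (u n) E) E :=
    ((((hasDerivAt_id E).sub_const _).mul ((hu (n+1)) E).hasDerivAt).sub
      (((hu n) E).hasDerivAt.const_mul _))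
  have h3 : (fun E => a (n+1) * u (n+2) E) = (fun E => (E - b (n+1)) * u (n+1) E - a n * u n E) :=
    funext (hr n)
  rw [h3] at h1
  have h4 := h1.unique h2
  have h5 := hr n E
  linear_combination u (n+1) E * h4 - deriv (u (n+1)) E * h5

lemma aux_norm (a b : ℕ → ℝ) (n : ℕ) (E x y : ℝ) :
    (jacobiSol a b E 0 (n+1) * x + jacobiSol a b E (Real.pi/2) (n+1) * y) ^ 2 +
    (jacobiSol a b E 0 n * x + jacobiSol a b E (Real.pi/2) n * y) ^ 2
      ≤ (matOpNorm (transferT a b n E)) ^ 2 * (x ^ 2 + y ^ 2) := by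
  have h := (LinearMap.toContinuousLinearMap
    (Matrix.toEuclideanLin (transferT a b n E))).le_opNorm (WithLp.toLp 2 ![x, y])
  have h2 := pow_le_pow_left₀ (norm_nonneg _) h 2
  rw [mul_pow, EuclideanSpace.real_norm_sq_eq, EuclideanSpace.real_norm_sq_eq] at h2
  simpa [Fin.sum_univ_two, transferT, matOpNorm, Matrix.toEuclideanLin,
    Matrix.vecHead, Matrix.vecTail, mul_comm] using h2

lemma aux_amgm (a : ℕ → ℝ) (ha : ∀ n, 0 < a n) (ha0 : a 0 = 1) (n : ℕ) :
    ((n+1 : ℕ) : ℝ) + Real.log (1 + a (n+1) ^ 2)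
      ≤ ∑ j ∈ Finset.range (n+1), (1 + a (j+1) ^ 2) / a j ^ 2 := by
  induction n with
  | zero =>
    have := Real.log_le_sub_one_of_pos (show 0 < 1 + a 1 ^ 2 by positivity)
    simp [ha0]
    linarith
  | succ n ih =>
    rw [Finset.sum_range_succ]
    have h0 : 0 < a (n+1) := ha _
    have h1 := Real.log_le_sub_one_of_pos (show 0 < (1 + a (n+1+1) ^ 2) / a (n+1) ^ 2 by positivity)
    rw [Real.log_div (by positivity) (by positivity)] at h1
    have h2 : Real.log (a (n+1) ^ 2) ≤ Real.log (1 + a (n+1) ^ 2) :=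
      Real.log_le_log (by positivity) (by linarith)
    push_cast at *
    linarith

lemma aux_exists (a : ℕ → ℝ) (ha : ∀ n, 0 < a n) (ha0 : a 0 = 1) (n : ℕ) (hn : 1 ≤ n) :
    ∃ m < n, a m * a n ≤ 1 + a (m+1) ^ 2 := by
  by_contra! hcon
  have key : ∀ k ≤ n, a n ≤ a (n - k) := by
    intro k
    induction k with
    | zero => simp
    | succ k ih =>
      intro hk
      have h1 := ih (by omega)
      have h2 := hcon (n - (k+1)) (by omega)
      have h3 : n - (k+1) + 1 = n - k := by omega
      rw [h3] at h2
      have h4 := ha n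
      by_contra! h5
      nlinarith [ha (n - (k+1))]
  have h1 := key n le_rfl
  have h2 := hcon 0 (by omega)
  simp [ha0] at h1 h2
  nlinarith [sq_nonneg (a 1)]

/-- inverse bound -/
lemma aux_inv (A p q r s N c d : ℝ) (hN : 0 ≤ N)
    (hdet : A * (p * s - r * q) = 1)
    (hb : ∀ x y : ℝ, (p * x + q * y) ^ 2 + (r * x + s * y) ^ 2 ≤ N * (x ^ 2 + y ^ 2)) :
    c ^ 2 + d ^ 2 ≤ A ^ 2 * N * ((p * c + q * d) ^ 2 + (r * c + s * d) ^ 2) := by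
  set X := p * c + q * d with hX
  set Y := r * c + s * d with hY
  have hb' := hb (-d) c
  have h1 : c ^ 2 + d ^ 2 = A * (X * (r * (-d) + s * c) - Y * (p * (-d) + q * c)) := by
    rw [hX, hY]
    linear_combination (-(c ^ 2 + d ^ 2)) * hdet
  set P := p * (-d) + q * c
  set Q := r * (-d) + s * c
  have h2 : (X * Q - Y * P) ^ 2 ≤ (X ^ 2 + Y ^ 2) * (P ^ 2 + Q ^ 2) := by
    nlinarith [sq_nonneg (X * P + Y * Q)]
  have h3 : (c ^ 2 + d ^ 2) * (c ^ 2 + d ^ 2)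
      ≤ (A ^ 2 * N * (X ^ 2 + Y ^ 2)) * (c ^ 2 + d ^ 2) := by
    calc (c ^ 2 + d ^ 2) * (c ^ 2 + d ^ 2) = A ^ 2 * (X * Q - Y * P) ^ 2 := by
          rw [h1]; ring
      _ ≤ A ^ 2 * ((X ^ 2 + Y ^ 2) * (P ^ 2 + Q ^ 2)) := by gcongr
      _ ≤ A ^ 2 * ((X ^ 2 + Y ^ 2) * (N * ((-d) ^ 2 + c ^ 2))) := by gcongr
      _ = _ := by ring
  rcases (show 0 ≤ c ^ 2 + d ^ 2 by positivity).eq_or_lt with h | h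
  · rw [← h]; positivity
  · exact le_of_mul_le_mul_right h3 h

lemma aux_cd_sum (a b : ℕ → ℝ) (u : ℕ → ℝ → ℝ) (hu : ∀ n, Differentiable ℝ (u n))
    (hr : ∀ n E, a (n+1) * u (n+2) E = (E - b (n+1)) * u (n+1) E - a n * u n E)
    (E : ℝ) (m n : ℕ) (hmn : m ≤ n) :
    a n * (deriv (u (n+1)) E * u n E - u (n+1) E * deriv (u n) E)
      = a m * (deriv (u (m+1)) E * u m E - u (m+1) E * deriv (u m) E)
        + ∑ j ∈ Finset.Ico m n, u (j+1) E ^ 2 := by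
  induction n, hmn using Nat.le_induction with
  | base => simp
  | succ n hmn ih =>
    rw [Finset.sum_Ico_succ_top hmn, aux_cd a b u hu hr n E, ih]
    ring

lemma aux_H (a b : ℕ → ℝ) (Δ : Set ℝ) (τ : ℝ)
    (hτ : ∀ (n : ℕ), ∀ E ∈ Δ, (1 + (a (n+1)) ^ 2) * (matOpNorm (transferT a b n E)) ^ 2 ≤ τ)
    (n : ℕ) (E : ℝ) (hE : E ∈ Δ) (x y : ℝ) :
    (jacobiSol a b E 0 (n+1) * x + jacobiSol a b E (Real.pi/2) (n+1) * y) ^ 2 +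
    (jacobiSol a b E 0 n * x + jacobiSol a b E (Real.pi/2) n * y) ^ 2
      ≤ τ / (1 + a (n+1) ^ 2) * (x ^ 2 + y ^ 2) := by
  refine (aux_norm a b n E x y).trans ?_
  gcongr
  rw [le_div_iff₀ (by positivity), mul_comm]
  exact hτ n E hE

lemma aux_tau (a b : ℕ → ℝ) (ha : ∀ n, 0 < a n) (ha0 : a 0 = 1) (Δ : Set ℝ) (τ : ℝ)
    (hτ : ∀ (n : ℕ), ∀ E ∈ Δ, (1 + (a (n+1)) ^ 2) * (matOpNorm (transferT a b n E)) ^ 2 ≤ τ)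
    (E : ℝ) (hE : E ∈ Δ) : 0 < τ := by
  have h := aux_H a b Δ τ hτ 0 E hE 1 0
  simp [jacobiSol] at h
  by_contra! hc
  have := div_nonpos_of_nonpos_of_nonneg hc (show 0 ≤ 1 + a 1 ^ 2 by positivity)
  linarith

lemma aux_bd (a b : ℕ → ℝ) (ha : ∀ n, 0 < a n) (ha0 : a 0 = 1) (Δ : Set ℝ) (τ : ℝ)
    (hτ : ∀ (n : ℕ), ∀ E ∈ Δ, (1 + (a (n+1)) ^ 2) * (matOpNorm (transferT a b n E)) ^ 2 ≤ τ)
    (E : ℝ) (hE : E ∈ Δ) (m j : ℕ) (c d : ℝ) (u : ℕ → ℝ)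
    (hu : ∀ k, u k = jacobiSol a b E 0 k * c + jacobiSol a b E (Real.pi/2) k * d) :
    u j ^ 2 ≤ τ * (a m ^ 2 * (τ / (1 + a (m+1) ^ 2))) * (u (m+1) ^ 2 + u m ^ 2) := by
  have hτ0 := aux_tau a b ha ha0 Δ τ hτ E hE
  have h1 := aux_inv (a m) _ _ _ _ (τ / (1 + a (m+1) ^ 2)) c d (by positivity)
    (aux_wron a b ha ha0 E m) (aux_H a b Δ τ hτ m E hE)
  rw [← hu, ← hu] at h1
  have h2 := aux_H a b Δ τ hτ j E hE c d
  rw [← hu, ← hu] at h2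
  have h3 : τ / (1 + a (j+1) ^ 2) ≤ τ := div_le_self hτ0.le (by nlinarith [sq_nonneg (a (j+1))])
  calc u j ^ 2 ≤ τ / (1 + a (j+1) ^ 2) * (c ^ 2 + d ^ 2) := by nlinarith [sq_nonneg (u (j+1))]
    _ ≤ τ * (a m ^ 2 * (τ / (1 + a (m+1) ^ 2)) * (u (m+1) ^ 2 + u m ^ 2)) := by gcongr
    _ = _ := by ring

lemma aux_sum_phi (a b : ℕ → ℝ) (ha : ∀ n, 0 < a n) (n : ℕ) (E : ℝ) :
    a n * (deriv (fun E => jacobiSol a b E 0 (n+1)) E * jacobiSol a b E 0 n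
      - jacobiSol a b E 0 (n+1) * deriv (fun E => jacobiSol a b E 0 n) E)
      = ∑ j ∈ Finset.range n, jacobiSol a b E 0 (j+1) ^ 2 := by
  have h := aux_cd_sum a b (fun n E => jacobiSol a b E 0 n) (aux_diff a b 0)
    (fun n E => aux_rec a b ha 0 E n) E 0 n (Nat.zero_le n)
  rw [h, Finset.range_eq_Ico]
  have e0 : ∀ E, jacobiSol a b E 0 0 = 0 := fun E => by simp [jacobiSol]
  simp only [e0, deriv_const, mul_zero, sub_zero, zero_add]

lemma aux_main_upper (a b : ℕ → ℝ) (ha : ∀ n, 0 < a n) (ha0 : a 0 = 1) (Δ : Set ℝ) (τ : ℝ)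
    (hτ : ∀ (n : ℕ), ∀ E ∈ Δ, (1 + (a (n+1)) ^ 2) * (matOpNorm (transferT a b n E)) ^ 2 ≤ τ)
    (n : ℕ) (hn : 1 ≤ n) (p q : ℝ) (hpq : p ≤ q) (hs : Set.Icc p q ⊆ Δ)
    (hne : ∀ x ∈ Set.Icc p q, orthoP a b n x ≠ 0) :
    q - p < 2 * a n * Real.pi * τ ^ 2 / n := by
  have hτ0 := aux_tau a b ha ha0 Δ τ hτ p (hs (Set.left_mem_Icc.2 hpq))
  have han := ha n
  have hn0 : (0 : ℝ) < n := by exact_mod_cast hn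
  have key := aux_upper (fun E => jacobiSol a b E 0 (n+1)) (fun E => jacobiSol a b E 0 n)
    _ _ (fun x => (aux_diff a b 0 (n+1) x).hasDerivAt) (fun x => (aux_diff a b 0 n x).hasDerivAt)
    (n / (2 * a n * τ ^ 2)) p q hpq ?_ hne
  · rw [lt_div_iff₀ hn0]
    rw [div_mul_eq_mul_div, div_lt_iff₀ (by positivity)] at key
    linarith
  · intro x hx
    have hxΔ := hs hx
    have h1 := aux_sum_phi a b ha n x
    have h2 := aux_H a b Δ τ hτ n x hxΔ 1 0
    simp only [mul_one, mul_zero, add_zero, one_pow, ne_eq, OfNat.ofNat_ne_zero,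
      not_false_eq_true, zero_pow] at h2
    have h3 : τ / (1 + a (n+1) ^ 2) ≤ τ :=
      div_le_self hτ0.le (by nlinarith [sq_nonneg (a (n+1))])
    have h4 : ∀ j, (1 + a (j+1) ^ 2) / a j ^ 2 ≤
        τ * (jacobiSol a b x 0 (j+1) ^ 2 + jacobiSol a b x 0 j ^ 2) := by
      intro j
      have haj := ha j
      have := aux_inv (a j) _ _ _ _ (τ / (1 + a (j+1) ^ 2)) 1 0 (by positivity)
        (aux_wron a b ha ha0 x j) (aux_H a b Δ τ hτ j x hxΔ)
      simp only [mul_one, mul_zero, add_zero, one_pow, ne_eq, OfNat.ofNat_ne_zero,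
        not_false_eq_true, zero_pow] at this
      rw [div_le_iff₀ (by positivity)]
      rw [mul_div_assoc', div_mul_eq_mul_div, le_div_iff₀ (by positivity)] at this
      linarith
    have h5 : (n : ℝ) ≤ ∑ j ∈ Finset.range n, (1 + a (j+1) ^ 2) / a j ^ 2 := by
      obtain ⟨k, rfl⟩ : ∃ k, n = k + 1 := ⟨n - 1, by omega⟩
      have h := aux_amgm a ha ha0 k
      have : 0 ≤ Real.log (1 + a (k+1) ^ 2) :=
        Real.log_nonneg (by nlinarith [sq_nonneg (a (k+1))])
      linarith
    have h6 : ∑ j ∈ Finset.range n, (1 + a (j+1) ^ 2) / a j ^ 2 ≤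
        ∑ j ∈ Finset.range n, τ * (jacobiSol a b x 0 (j+1) ^ 2 + jacobiSol a b x 0 j ^ 2) :=
      Finset.sum_le_sum (fun j _ => h4 j)
    rw [← Finset.mul_sum, Finset.sum_add_distrib] at h6
    have h7 : ∑ j ∈ Finset.range n, jacobiSol a b x 0 j ^ 2
        ≤ ∑ j ∈ Finset.range n, jacobiSol a b x 0 (j+1) ^ 2 := by
      have e1 := Finset.sum_range_succ (fun j => jacobiSol a b x 0 j ^ 2) n
      have e2 := Finset.sum_range_succ' (fun j => jacobiSol a b x 0 j ^ 2) n
      have e3 : jacobiSol a b x 0 0 = 0 := by simp [jacobiSol]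
      simp only [e3] at e2
      nlinarith [sq_nonneg (jacobiSol a b x 0 n)]
    set S := ∑ j ∈ Finset.range n, jacobiSol a b x 0 (j+1) ^ 2
    set W := deriv (fun E => jacobiSol a b E 0 (n+1)) x * jacobiSol a b x 0 n
      - jacobiSol a b x 0 (n+1) * deriv (fun E => jacobiSol a b E 0 n) x
    have h8 : (n : ℝ) ≤ τ * (2 * S) := by
      have := mul_le_mul_of_nonneg_left h7 hτ0.le
      linarith
    have h9 : n / (2 * a n * τ ^ 2) * (jacobiSol a b x 0 (n+1) ^ 2 + jacobiSol a b x 0 n ^ 2)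
        ≤ n / (2 * a n * τ ^ 2) * τ := by
      gcongr
      linarith
    refine h9.trans ?_
    rw [div_mul_eq_mul_div, div_le_iff₀ (by positivity)]
    have := mul_le_mul_of_nonneg_right h8 hτ0.le
    rw [← h1] at this
    linarith

lemma aux_main_lower (a b : ℕ → ℝ) (ha : ∀ n, 0 < a n) (ha0 : a 0 = 1) (Δ : Set ℝ) (τ : ℝ)
    (hτ : ∀ (n : ℕ), ∀ E ∈ Δ, (1 + (a (n+1)) ^ 2) * (matOpNorm (transferT a b n E)) ^ 2 ≤ τ)
    (n : ℕ) (hn : 1 ≤ n) (p q : ℝ) (hpq : p < q) (hs : Set.Icc p q ⊆ Δ)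
    (hp : orthoP a b n p = 0) (hq : orthoP a b n q = 0)
    (hne : ∀ x ∈ Set.Ioo p q, orthoP a b n x ≠ 0) :
    a n * Real.pi / (τ ^ 2 * n) ≤ q - p := by
  have hτ0 := aux_tau a b ha ha0 Δ τ hτ p (hs (Set.left_mem_Icc.2 hpq.le))
  have han := ha n
  have hn0 : (0 : ℝ) < n := by exact_mod_cast hn
  obtain ⟨m, hmn, hm⟩ := aux_exists a ha ha0 n hn
  have ham := ha m
  let φ : ℕ → ℝ → ℝ := fun k E => jacobiSol a b E 0 k
  let ψ : ℕ → ℝ → ℝ := fun k E => jacobiSol a b E (Real.pi/2) k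
  have hφd : ∀ k, Differentiable ℝ (φ k) := aux_diff a b 0
  have hψd : ∀ k, Differentiable ℝ (ψ k) := aux_diff a b (Real.pi/2)
  have hφr : ∀ k E, a (k+1) * φ (k+2) E = (E - b (k+1)) * φ (k+1) E - a k * φ k E :=
    fun k E => aux_rec a b ha 0 E k
  have hψr : ∀ k E, a (k+1) * ψ (k+2) E = (E - b (k+1)) * ψ (k+1) E - a k * ψ k E :=
    fun k E => aux_rec a b ha (Real.pi/2) E k
  have hdet : ∀ k E, a k * (φ (k+1) E * ψ k E - φ k E * ψ (k+1) E) = 1 :=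
    fun k E => aux_wron a b ha ha0 E k
  obtain ⟨v, hv⟩ : ∃ v : ℕ → ℝ → ℝ, ∀ k E, v k E = φ (n+1) E * ψ k E - ψ (n+1) E * φ k E :=
    ⟨_, fun _ _ => rfl⟩
  have hvd : ∀ k, Differentiable ℝ (v k) := by
    intro k
    have : v k = fun E => φ (n+1) E * ψ k E - ψ (n+1) E * φ k E := funext (hv k)
    rw [this]
    exact ((hφd _).mul (hψd _)).sub ((hψd _).mul (hφd _))
  have hvr : ∀ k E, a (k+1) * v (k+2) E = (E - b (k+1)) * v (k+1) E - a k * v k E := by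
    intro k E
    rw [hv, hv, hv]
    linear_combination φ (n+1) E * hψr k E - ψ (n+1) E * hφr k E
  have hFφ : ∀ E, a m * (φ (m+1) E * v m E - φ m E * v (m+1) E) = φ (n+1) E := by
    intro E
    rw [hv, hv]
    linear_combination φ (n+1) E * hdet m E
  have hF0 : ∀ E, φ (m+1) E * v m E - φ m E * v (m+1) E = 0 ↔ φ (n+1) E = 0 := by
    intro E
    rw [← hFφ E]
    simp [ham.ne']
  have hvtop : v (n+1) = fun _ => 0 := by
    funext E; rw [hv]; ring
  have hWid : ∀ x, a m * ((deriv (φ (m+1)) x * v m x + φ (m+1) x * deriv (v m) x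
        - (deriv (φ m) x * v (m+1) x + φ m x * deriv (v (m+1)) x))
        * (φ (m+1) x * v (m+1) x + φ m x * v m x)
      - (φ (m+1) x * v m x - φ m x * v (m+1) x) *
        (deriv (φ (m+1)) x * v (m+1) x + φ (m+1) x * deriv (v (m+1)) x
        + (deriv (φ m) x * v m x + φ m x * deriv (v m) x)))
      = (v (m+1) x ^ 2 + v m x ^ 2) * (∑ j ∈ Finset.range m, φ (j+1) x ^ 2)
        + (φ (m+1) x ^ 2 + φ m x ^ 2) * (∑ j ∈ Finset.Ico m n, v (j+1) x ^ 2) := by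
    intro x
    have h1 : a m * (deriv (φ (m+1)) x * φ m x - φ (m+1) x * deriv (φ m) x)
      = ∑ j ∈ Finset.range m, φ (j+1) x ^ 2 := aux_sum_phi a b ha m x
    have h2 := aux_cd_sum a b v hvd hvr x m n hmn.le
    rw [hvtop] at h2
    simp only [deriv_const, zero_mul, sub_zero, mul_zero] at h2
    linear_combination (v (m+1) x ^ 2 + v m x ^ 2) * h1 + (φ (m+1) x ^ 2 + φ m x ^ 2) * h2
  have key := aux_lower (fun E => φ (m+1) E * v m E - φ m E * v (m+1) E)
    (fun E => φ (m+1) E * v (m+1) E + φ m E * v m E) _ _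
    (fun x => ((hφd (m+1) x).hasDerivAt.mul (hvd m x).hasDerivAt).sub
      ((hφd m x).hasDerivAt.mul (hvd (m+1) x).hasDerivAt))
    (fun x => ((hφd (m+1) x).hasDerivAt.mul (hvd (m+1) x).hasDerivAt).add
      ((hφd m x).hasDerivAt.mul (hvd m x).hasDerivAt))
    (n * τ ^ 2 / a n) p q hpq ?_ ?_ ((hF0 p).2 hp) ((hF0 q).2 hq)
    (fun x hx h => hne x hx ((hF0 x).1 h))
  · rw [div_le_iff₀ (by positivity)]
    rw [div_mul_eq_mul_div, le_div_iff₀ han] at key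
    linarith
  · intro x hx
    have hxΔ := hs hx
    have hW := hWid x
    set B := τ * (a m ^ 2 * (τ / (1 + a (m+1) ^ 2))) with hB
    have h1 : ∑ j ∈ Finset.range m, φ (j+1) x ^ 2 ≤ m * (B * (φ (m+1) x ^ 2 + φ m x ^ 2)) := by
      have := Finset.sum_le_card_nsmul (Finset.range m) (fun j => φ (j+1) x ^ 2)
        (B * (φ (m+1) x ^ 2 + φ m x ^ 2)) (fun j _ =>
          aux_bd a b ha ha0 Δ τ hτ x hxΔ m (j+1) 1 0 (fun k => φ k x) (fun k => by simp [φ]))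
      simpa using this
    have h2 : ∑ j ∈ Finset.Ico m n, v (j+1) x ^ 2
        ≤ ((n : ℝ) - m) * (B * (v (m+1) x ^ 2 + v m x ^ 2)) := by
      have := Finset.sum_le_card_nsmul (Finset.Ico m n) (fun j => v (j+1) x ^ 2)
        (B * (v (m+1) x ^ 2 + v m x ^ 2)) (fun j _ =>
          aux_bd a b ha ha0 Δ τ hτ x hxΔ m (j+1) (-ψ (n+1) x) (φ (n+1) x) (fun k => v k x)
            (fun k => by simp only [hv, φ, ψ]; ring))
      simpa [Nat.cast_sub hmn.le] using this
    have h3 := mul_le_mul_of_nonneg_left h1 (show 0 ≤ v (m+1) x ^ 2 + v m x ^ 2 by positivity)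
    have h4 := mul_le_mul_of_nonneg_left h2 (show 0 ≤ φ (m+1) x ^ 2 + φ m x ^ 2 by positivity)
    have h5 : B ≤ a m * (τ ^ 2 / a n) := by
      have : τ * (a m ^ 2 * (τ / (1 + a (m+1) ^ 2)))
          = a m * τ ^ 2 * (a m / (1 + a (m+1) ^ 2)) := by ring
      rw [hB, this]
      have h6 : a m / (1 + a (m+1) ^ 2) ≤ 1 / a n := by
        rw [div_le_div_iff₀ (by positivity) han]
        linarith
      calc _ ≤ a m * τ ^ 2 * (1 / a n) := by gcongr
        _ = _ := by ring
    have h6 : (v (m+1) x ^ 2 + v m x ^ 2) * (φ (m+1) x ^ 2 + φ m x ^ 2) * n * B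
        ≤ (v (m+1) x ^ 2 + v m x ^ 2) * (φ (m+1) x ^ 2 + φ m x ^ 2) * n * (a m * (τ ^ 2 / a n)) := by
      gcongr
    refine le_of_mul_le_mul_left ?_ ham
    refine hW.le.trans ?_
    calc _ ≤ (v (m+1) x ^ 2 + v m x ^ 2) * (φ (m+1) x ^ 2 + φ m x ^ 2) * n * B := by linarith
      _ ≤ _ := h6
      _ = _ := by ring
  · intro x hx
    have hW := hWid x
    refine pos_of_mul_pos_right (b := _) (a := a m) ?_ ham.le
    refine lt_of_lt_of_eq ?_ hW.symm
    have h1 : 0 < φ (m+1) x ^ 2 + φ m x ^ 2 := by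
      by_contra! hc
      have e1 : φ (m+1) x = 0 := by nlinarith [sq_nonneg (φ (m+1) x), sq_nonneg (φ m x)]
      have e2 : φ m x = 0 := by nlinarith [sq_nonneg (φ (m+1) x), sq_nonneg (φ m x)]
      have := hdet m x
      simp [e1, e2] at this
    have h2 : 0 < ∑ j ∈ Finset.Ico m n, v (j+1) x ^ 2 := by
      have hvn : v n x ≠ 0 := by
        intro h
        have := hdet n x
        rw [hv] at h
        have e : φ (n+1) x * ψ n x - φ n x * ψ (n+1) x = 0 := by linarith
        rw [e] at this
        simp at this
      refine Finset.sum_pos' (fun j _ => sq_nonneg _) ⟨n - 1, ?_, ?_⟩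
      · rw [Finset.mem_Ico]; omega
      · rw [Nat.sub_add_cancel hn]; positivity
    have h3 : 0 ≤ ∑ j ∈ Finset.range m, φ (j+1) x ^ 2 := Finset.sum_nonneg (fun j _ => sq_nonneg _)
    positivity

theorem stmt_11 (a b : ℕ → ℝ) (ha : ∀ n, 0 < a n) (ha0 : a 0 = 1)
    (Δ : Set ℝ) (hΔ : Δ.OrdConnected) (τ : ℝ)
    (hτ : ∀ (n : ℕ), ∀ E ∈ Δ, (1 + (a (n+1)) ^ 2) * (matOpNorm (transferT a b n E)) ^ 2 ≤ τ) :
    -- (a)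
    (∀ n : ℕ, 1 ≤ n → ∀ E ∈ Δ, ∀ E' ∈ Δ, E < E' →
      orthoP a b n E = 0 → orthoP a b n E' = 0 →
      (∀ x ∈ Set.Ioo E E', orthoP a b n x ≠ 0) →
      a n * Real.pi / (τ ^ 2 * n) ≤ E' - E ∧ E' - E ≤ 2 * a n * Real.pi * τ ^ 2 / n) ∧
    -- (b)
    (∀ α β : ℝ, Δ = Set.Icc α β → ∀ n : ℕ, 1 ≤ n →
      2 * a n * Real.pi * τ ^ 2 / n ≤ β - α →
      (∃ x ∈ Set.Icc (β - 2 * a n * Real.pi * τ ^ 2 / n) β, orthoP a b n x = 0) ∧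
      (∃ x ∈ Set.Icc α (α + 2 * a n * Real.pi * τ ^ 2 / n), orthoP a b n x = 0)) := by
  constructor
  · intro n hn E hE E' hE' hlt h0 h0' hne
    have hs : Set.Icc E E' ⊆ Δ := hΔ.out hE hE'
    refine ⟨aux_main_lower a b ha ha0 Δ τ hτ n hn E E' hlt hs h0 h0' hne, ?_⟩
    by_contra! hc
    have hτ0 := aux_tau a b ha ha0 Δ τ hτ E hE
    have hL : 0 ≤ 2 * a n * Real.pi * τ ^ 2 / n := by
      have := ha n
      have := Real.pi_pos
      positivity
    set L := 2 * a n * Real.pi * τ ^ 2 / n with hLdef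
    have hin : ∀ x ∈ Set.Icc (E + (E' - E - L) / 2) (E' - (E' - E - L) / 2), x ∈ Set.Ioo E E' := by
      intro x hx
      constructor
      · linarith [hx.1]
      · linarith [hx.2]
    have := aux_main_upper a b ha ha0 Δ τ hτ n hn (E + (E' - E - L) / 2) (E' - (E' - E - L) / 2)
      (by linarith) (fun x hx => hs (Set.Ioo_subset_Icc_self (hin x hx)))
      (fun x hx => hne x (hin x hx))
    linarith
  · intro α β hΔe n hn hle
    have hL : 0 ≤ 2 * a n * Real.pi * τ ^ 2 / n := by
      have := ha n
      have := Real.pi_pos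
      positivity
    set L := 2 * a n * Real.pi * τ ^ 2 / n with hLdef
    constructor
    · by_contra! hc
      have := aux_main_upper a b ha ha0 Δ τ hτ n hn (β - L) β (by linarith)
        (by rw [hΔe]; exact Set.Icc_subset_Icc (by linarith) le_rfl) hc
      linarith
    · by_contra! hc
      have := aux_main_upper a b ha ha0 Δ τ hτ n hn α (α + L) (by linarith)
        (by rw [hΔe]; exact Set.Icc_subset_Icc le_rfl (by linarith)) hc
      linarith
end
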